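/- Fix positive integers n, K, d, a real β > 0, feature vectors u : Fin n → (Fin d → ℝ), and one-hot labels y : Fin n → Fin K → ℝ where for each i there is exactly one class c i with y i (c i) = 1 and y i k = 0 otherwise. Let p*_{ik} = (∑_{i'} y_{i'k} · 1[u_{i'} = u_i]) / (#{i' : u_{i'} = u_i}). Then a predictor g with g(u_i)_{c i} > 0 for all i is a global minimizer of L over all predictors h with h(u_i)_{c i} > 0 for all i, if and only if g(u_i)_k = p*_{ik} for every i and k. Moreover, in that case the class-wise expected calibration error ECE(g) = (1/K) ∑_k |(1/n) ∑_i g(u_i)_k − (1/n) ∑_i y_{ik}| equals 0. -/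

import Mathlib

open scoped Classical

/-- Conditional-frequency values: `pstar u y i k` is the fraction of samples `i'`
with the same feature vector as `i` that have label `k`. -/
noncomputable def pstar {n d K : ℕ} (u : Fin n → Fin d → ℝ)
    (y : Fin n → Fin K → ℝ) (i : Fin n) (k : Fin K) : ℝ :=
  (∑ i', y i' k * (if u i' = u i then (1 : ℝ) else 0)) /
    ((Finset.univ.filter fun i' => u i' = u i).card : ℝ)

/-- The calibrated loss: cross-entropy plus `β` times the bin-free class-wise
calibration term. -/
noncomputable def loss {n d K : ℕ} (β : ℝ) (u : Fin n → Fin d → ℝ)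
    (y : Fin n → Fin K → ℝ) (g : (Fin d → ℝ) → Fin K → ℝ) : ℝ :=
  -((1 / (n : ℝ)) * ∑ i, ∑ k, y i k * Real.log (g (u i) k)) +
    β * ((1 / (K : ℝ)) *
      ∑ k, |(1 / (n : ℝ)) * ∑ i, g (u i) k - (1 / (n : ℝ)) * ∑ i, y i k|)

/-- The class-wise expected calibration error of a predictor on the training data. -/
noncomputable def ece {n d K : ℕ} (u : Fin n → Fin d → ℝ)
    (y : Fin n → Fin K → ℝ) (g : (Fin d → ℝ) → Fin K → ℝ) : ℝ :=
  (1 / (K : ℝ)) *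
    ∑ k, |(1 / (n : ℝ)) * ∑ i, g (u i) k - (1 / (n : ℝ)) * ∑ i, y i k|

/-- The pointwise Gibbs gap, whose sum over a probability vector is the Kullback-Leibler
divergence. -/
noncomputable def gibbsGap (p q : ℝ) : ℝ :=
  p * Real.log p - p * Real.log q + q - p

theorem gibbsGap_self (p : ℝ) : gibbsGap p p = 0 := by
  unfold gibbsGap
  ring

theorem gibbsGap_pos {p q : ℝ} (hp : 0 ≤ p) (hq : 0 ≤ q) (hpq : 0 < p → 0 < q) (hne : q ≠ p) :
    0 < gibbsGap p q := by
  unfold gibbsGap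
  rcases hp.eq_or_lt with rfl | hp
  · simpa using hq.lt_of_ne' hne
  · have hq := hpq hp
    have h := Real.log_lt_sub_one_of_pos (div_pos hq hp)
      (fun h => hne ((div_eq_one_iff_eq hp.ne').1 h))
    rw [Real.log_div hq.ne' hp.ne'] at h
    have h2 := mul_lt_mul_of_pos_left h hp
    have h3 : p * (q / p - 1) = q - p := by field_simp
    linarith

theorem gibbsGap_nonneg {p q : ℝ} (hp : 0 ≤ p) (hq : 0 ≤ q) (hpq : 0 < p → 0 < q) :
    0 ≤ gibbsGap p q := by
  by_cases h : q = p
  · rw [h, gibbsGap_self]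
  · exact (gibbsGap_pos hp hq hpq h).le

section pstar

variable {n d K : ℕ} {u : Fin n → Fin d → ℝ} {y : Fin n → Fin K → ℝ}

theorem card_fiber_pos (u : Fin n → Fin d → ℝ) (i : Fin n) :
    (0 : ℝ) < ((Finset.univ.filter fun i' => u i' = u i).card : ℝ) := by
  exact_mod_cast Finset.card_pos.2 ⟨i, by simp⟩

theorem pstar_congr {i j : Fin n} (h : u i = u j) : pstar u y i = pstar u y j := by
  funext k
  simp only [pstar, h]

/-- Averaging labels over equal features does not change sums against functions of the
features. -/
theorem sum_pstar_mul (f : (Fin d → ℝ) → ℝ) (k : Fin K) :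
    ∑ i, pstar u y i k * f (u i) = ∑ i, y i k * f (u i) := by
  simp only [pstar, Finset.sum_div, Finset.sum_mul]
  rw [Finset.sum_comm]
  refine Finset.sum_congr rfl fun j _ => ?_
  have hterm : ∀ i, y j k * (if u j = u i then (1 : ℝ) else 0) /
      ((Finset.univ.filter fun i' => u i' = u i).card : ℝ) * f (u i) =
      if u i = u j then y j k * f (u j) /
        ((Finset.univ.filter fun i' => u i' = u j).card : ℝ) else 0 := by
    intro i
    by_cases h : u i = u j
    · simp only [h, if_true]
      ring
    · simp [h, Ne.symm h]
  rw [Finset.sum_congr rfl fun i _ => hterm i, ← Finset.sum_filter, Finset.sum_const,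
    nsmul_eq_mul, mul_div_cancel₀ _ (card_fiber_pos u j).ne']

theorem pstar_nonneg (hy : ∀ i k, 0 ≤ y i k) (i : Fin n) (k : Fin K) : 0 ≤ pstar u y i k :=
  div_nonneg (Finset.sum_nonneg fun j _ => mul_nonneg (hy j k) (by split_ifs <;> norm_num))
    (Nat.cast_nonneg _)

theorem sum_pstar (hy : ∀ i, ∑ k, y i k = 1) (i : Fin n) : ∑ k, pstar u y i k = 1 := by
  simp only [pstar]
  rw [← Finset.sum_div, Finset.sum_comm, div_eq_one_iff_eq (card_fiber_pos u i).ne']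
  simp [hy]

theorem pstar_pos (hy : ∀ i k, 0 ≤ y i k) {i : Fin n} {k : Fin K} (h : 0 < y i k) :
    0 < pstar u y i k := by
  refine div_pos (Finset.sum_pos' (fun j _ => mul_nonneg (hy j k) (by split_ifs <;> norm_num))
    ⟨i, Finset.mem_univ i, ?_⟩) (card_fiber_pos u i)
  simpa using h

theorem exists_label_ne_zero_of_pstar_pos {i : Fin n} {k : Fin K} (h : 0 < pstar u y i k) :
    ∃ j, u j = u i ∧ y j k ≠ 0 := by
  by_contra! hc
  refine h.ne' ?_
  rw [pstar, Finset.sum_eq_zero, zero_div]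
  intro j _
  by_cases hj : u j = u i
  · simp [hc j hj]
  · simp [hj]

theorem ece_nonneg (g : (Fin d → ℝ) → Fin K → ℝ) : 0 ≤ ece u y g :=
  mul_nonneg (by positivity) (Finset.sum_nonneg fun _ _ => abs_nonneg _)

theorem ece_eq_zero_of_eq_pstar {g : (Fin d → ℝ) → Fin K → ℝ}
    (h : ∀ i k, g (u i) k = pstar u y i k) : ece u y g = 0 := by
  have hs : ∀ k, ∑ i, g (u i) k = ∑ i, y i k := fun k => by
    simpa [h] using sum_pstar_mul (u := u) (y := y) (fun _ => 1) k
  simp [ece, hs]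

/-- The loss is the conditional entropy, plus the mean Kullback-Leibler divergence from `pstar`,
plus `β` times the calibration error. -/
theorem loss_eq_entropy_add_gibbsGap_add_ece (β : ℝ) (hy : ∀ i, ∑ k, y i k = 1)
    {h : (Fin d → ℝ) → Fin K → ℝ} (h1 : ∀ x, ∑ k, h x k = 1) :
    loss β u y h =
      -((1 / (n : ℝ)) * ∑ i, ∑ k, pstar u y i k * Real.log (pstar u y i k)) +
        (1 / (n : ℝ)) * ∑ i, ∑ k, gibbsGap (pstar u y i k) (h (u i) k) + β * ece u y h := by
  have hce : ∑ i, ∑ k, y i k * Real.log (h (u i) k) =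
      ∑ i, ∑ k, pstar u y i k * Real.log (h (u i) k) := by
    rw [Finset.sum_comm, Finset.sum_comm (f := fun i k => pstar u y i k * _)]
    exact Finset.sum_congr rfl fun k _ => (sum_pstar_mul (fun x => Real.log (h x k)) k).symm
  have hgap : ∑ i, ∑ k, gibbsGap (pstar u y i k) (h (u i) k) =
      ∑ i, ∑ k, pstar u y i k * Real.log (pstar u y i k) -
        ∑ i, ∑ k, pstar u y i k * Real.log (h (u i) k) := by
    simp [gibbsGap, Finset.sum_add_distrib, Finset.sum_sub_distrib, h1, sum_pstar hy]
  rw [loss, hce, hgap, ece]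
  ring

end pstar

/-- A predictor `g` (positive on the true labels) is a global minimizer of the loss
among all such predictors iff it outputs the conditional frequencies `p*` on the
training features; in that case its class-wise expected calibration error is `0`. -/
theorem global_min_iff_pstar_and_ece_zero (n K d : ℕ)
    (hn : 0 < n) (hK : 0 < K) (hd : 0 < d) (β : ℝ) (hβ : 0 < β)
    (u : Fin n → Fin d → ℝ) (y : Fin n → Fin K → ℝ) (c : Fin n → Fin K)
    (hy : ∀ i, y i (c i) = 1 ∧ ∀ k, k ≠ c i → y i k = 0)
    (g : (Fin d → ℝ) → Fin K → ℝ)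
    (hg0 : ∀ x k, 0 ≤ g x k) (hg1 : ∀ x, ∑ k, g x k = 1)
    (hgpos : ∀ i, 0 < g (u i) (c i)) :
    ((∀ h : (Fin d → ℝ) → Fin K → ℝ,
        (∀ x k, 0 ≤ h x k) → (∀ x, ∑ k, h x k = 1) →
        (∀ i, 0 < h (u i) (c i)) →
        loss β u y g ≤ loss β u y h) ↔
      (∀ i k, g (u i) k = pstar u y i k)) ∧
    ((∀ i k, g (u i) k = pstar u y i k) → ece u y g = 0) := by
  have hy0 : ∀ i k, 0 ≤ y i k := fun i k => by
    by_cases h : k = c i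
    · rw [h, (hy i).1]
      exact zero_le_one
    · rw [(hy i).2 k h]
  have hy1 : ∀ i, ∑ k, y i k = 1 := fun i => by
    rw [Finset.sum_eq_single (c i) (fun k _ h => (hy i).2 k h) (by simp), (hy i).1]
  have hsupp : ∀ h : (Fin d → ℝ) → Fin K → ℝ, (∀ i, 0 < h (u i) (c i)) →
      ∀ i k, 0 < pstar u y i k → 0 < h (u i) k := by
    intro h hpos i k hp
    obtain ⟨j, hj, hjk⟩ := exists_label_ne_zero_of_pstar_pos hp
    have hk : k = c j := by
      by_contra hne
      exact hjk ((hy j).2 k hne)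
    rw [← hj, hk]
    exact hpos j
  have hgap : ∀ h : (Fin d → ℝ) → Fin K → ℝ, (∀ x k, 0 ≤ h x k) → (∀ i, 0 < h (u i) (c i)) →
      ∀ i k, 0 ≤ gibbsGap (pstar u y i k) (h (u i) k) := fun h h0 hpos i k =>
    gibbsGap_nonneg (pstar_nonneg hy0 i k) (h0 _ _) (hsupp h hpos i k)
  have hn' : (0 : ℝ) < 1 / (n : ℝ) := by positivity
  refine ⟨⟨fun hmin => ?_, fun hg h h0 h1 hpos => ?_⟩, ece_eq_zero_of_eq_pstar⟩
  · let F : (Fin d → ℝ) → Fin K → ℝ := fun x =>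
      if hx : ∃ i, u i = x then pstar u y hx.choose else g x
    have hF : ∀ i, F (u i) = pstar u y i := fun i => by
      have hx : ∃ j, u j = u i := ⟨i, rfl⟩
      simp only [F, dif_pos hx]
      exact pstar_congr hx.choose_spec
    have hF1 : ∀ x, ∑ k, F x k = 1 := fun x => by
      by_cases hx : ∃ i, u i = x
      · obtain ⟨i, rfl⟩ := hx
        rw [hF, sum_pstar hy1]
      · simp only [F, dif_neg hx, hg1]
    have hF0 : ∀ x k, 0 ≤ F x k := fun x k => by
      by_cases hx : ∃ i, u i = x
      · obtain ⟨i, rfl⟩ := hx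
        rw [hF]
        exact pstar_nonneg hy0 i k
      · simp only [F, dif_neg hx, hg0]
    have hle := hmin F hF0 hF1 fun i => by
      rw [hF]
      exact pstar_pos hy0 (by rw [(hy i).1]; exact zero_lt_one)
    rw [loss_eq_entropy_add_gibbsGap_add_ece β hy1 hg1,
      loss_eq_entropy_add_gibbsGap_add_ece β hy1 hF1,
      ece_eq_zero_of_eq_pstar (g := F) fun i k => by rw [hF]] at hle
    simp only [hF, gibbsGap_self, Finset.sum_const_zero, mul_zero, add_zero] at hle
    have hece := mul_nonneg hβ.le (ece_nonneg (u := u) (y := y) g)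
    intro i k
    by_contra hne
    have hpos := gibbsGap_pos (pstar_nonneg hy0 i k) (hg0 _ _) (hsupp g hgpos i k) hne
    have hsum : 0 < ∑ i, ∑ k, gibbsGap (pstar u y i k) (g (u i) k) :=
      Finset.sum_pos' (fun j _ => Finset.sum_nonneg fun l _ => hgap g hg0 hgpos j l)
        ⟨i, Finset.mem_univ i, Finset.sum_pos' (fun l _ => hgap g hg0 hgpos i l)
          ⟨k, Finset.mem_univ k, hpos⟩⟩
    have := mul_pos hn' hsum
    linarith
  · rw [loss_eq_entropy_add_gibbsGap_add_ece β hy1 hg1,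
      loss_eq_entropy_add_gibbsGap_add_ece β hy1 h1, ece_eq_zero_of_eq_pstar hg]
    simp only [hg, gibbsGap_self, Finset.sum_const_zero, mul_zero, add_zero]
    have hece := mul_nonneg hβ.le (ece_nonneg (u := u) (y := y) h)
    have hsum := mul_nonneg hn'.le (Finset.sum_nonneg fun i (_ : i ∈ Finset.univ) =>
      Finset.sum_nonneg fun k (_ : k ∈ Finset.univ) => hgap h h0 hpos i k)
    linarith
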